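/- arXiv:2106.02109 — 3 statements merged into one kernel-verified Lean document; each statement's English description precedes it below -/
import Mathlib

section
/- For all x ≥ e/2, ln(2x)·QL(x) < a_𝓛(x) and a_𝓡(x) < ln(2x)·QR(x). -/
noncomputable def L (x : ℝ) : ℝ := Real.pi ^ (1 / (2 * x)) * Real.exp (1 / ((12 * x + 1) * x))
noncomputable def R (x : ℝ) : ℝ := Real.pi ^ (1 / (2 * x)) * Real.exp (1 / (12 * x ^ 2))
noncomputable def P (x : ℝ) : ℝ := x ^ (1 / x)
noncomputable def aF (F : ℝ → ℝ) (x : ℝ) : ℝ := (F x - 1) * x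
noncomputable def calL (x : ℝ) : ℝ := L x * P (2 * x)
noncomputable def calR (x : ℝ) : ℝ := R x * P (2 * x)
noncomputable def p (x : ℝ) : ℝ := P (2 * x)

noncomputable def QL (x : ℝ) : ℝ :=
  (Real.log Real.pi / 2) / Real.log (2 * x) + (1 / 2) * (1 + (Real.log Real.pi / 2) / x)
noncomputable def QR (x : ℝ) : ℝ :=
  (2 / Real.log (2 * x) + 1) * (x / (2 * x - Real.log (2 * x)))
noncomputable def D (x : ℝ) : ℝ := Real.log (2 * x) * QR x - Real.log (2 * x) * QL x

lemma Real.log_pi_lt : Real.log Real.pi < 5 / 4 := by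
  rw [Real.log_lt_iff_lt_exp Real.pi_pos]
  have h : Real.exp (5 / 4) = Real.exp 1 * Real.exp (1 / 4) := by
    rw [← Real.exp_add]; norm_num
  nlinarith [Real.pi_lt_d2, Real.exp_one_gt_d9, Real.add_one_le_exp (1 / 4 : ℝ)]

lemma calL_eq_exp {x : ℝ} (hx : 0 < x) :
    calL x = Real.exp ((Real.log Real.pi / 2 + Real.log (2 * x) / 2 + 1 / (12 * x + 1)) / x) := by
  unfold calL L P
  rw [Real.rpow_def_of_pos Real.pi_pos, Real.rpow_def_of_pos (by positivity), ← Real.exp_add,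
    ← Real.exp_add]
  congr 1
  field_simp
  ring

lemma calR_eq_exp {x : ℝ} (hx : 0 < x) :
    calR x = Real.exp (Real.log (2 * x) / (2 * x)) *
      Real.exp ((Real.log Real.pi + 1 / (6 * x)) / (2 * x)) := by
  unfold calR R P
  rw [Real.rpow_def_of_pos Real.pi_pos, Real.rpow_def_of_pos (by positivity), ← Real.exp_add,
    ← Real.exp_add, ← Real.exp_add]
  congr 1
  field_simp
  ring

lemma lt_aF_calL {x : ℝ} (hx : 0 < x) (hl : 0 < Real.log (2 * x)) :
    Real.log (2 * x) * QL x < aF calL x := by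
  have hp : 0 < Real.log Real.pi := Real.log_pos (by linarith [Real.pi_gt_three])
  rw [aF, calL_eq_exp hx, QL]
  set l := Real.log (2 * x)
  set a := Real.log Real.pi
  set d := 1 / (12 * x + 1)
  have hd : 0 < d := by positivity
  have key := mul_le_mul_of_nonneg_right
    (Real.quadratic_le_exp_of_nonneg (x := (a / 2 + l / 2 + d) / x) (by positivity)) hx.le
  have e1 : l * (a / 2 / l + 1 / 2 * (1 + a / 2 / x)) = a / 2 + l / 2 + a * l / 4 / x := by
    field_simp
    ring
  have e2 : (1 + (a / 2 + l / 2 + d) / x + ((a / 2 + l / 2 + d) / x) ^ 2 / 2) * x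
      = x + (a / 2 + l / 2 + d) + (a / 2 + l / 2 + d) ^ 2 / 2 / x := by
    field_simp
  have e3 : a * l / 4 / x ≤ (a / 2 + l / 2 + d) ^ 2 / 2 / x := by
    refine div_le_div_of_nonneg_right ?_ hx.le
    nlinarith [mul_pos hp hl, mul_pos hp hd, mul_pos hl hd, sq_nonneg a, sq_nonneg l, sq_nonneg d]
  rw [e1]
  linarith

lemma exp_log_pi_add_div_lt {y : ℝ} (hy : 27 / 10 ≤ y) :
    Real.exp ((Real.log Real.pi + 1 / (3 * y)) / y) < 1 + 2 / y := by
  have hy0 : 0 < y := by linarith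
  rw [← Real.lt_log_iff_exp_lt (by positivity)]
  refine lt_of_lt_of_le ?_ (Real.le_log_one_add_of_nonneg (x := 2 / y) (by positivity))
  have h : 1 / (3 * y) ≤ 1 / 8 := by
    apply one_div_le_one_div_of_le <;> linarith
  have e : 2 * (2 / y) / (2 / y + 2) = 2 / (y + 1) := by
    field_simp
    ring
  rw [e, div_lt_div_iff₀ hy0 (by linarith)]
  nlinarith [Real.log_pi_lt]

lemma aF_calR_lt {x : ℝ} (hx : 27 / 10 ≤ 2 * x) :
    aF calR x < Real.log (2 * x) * QR x := by
  have hx0 : 0 < x := by linarith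
  have hl : 0 < Real.log (2 * x) := Real.log_pos (by linarith)
  have hly : Real.log (2 * x) < 2 * x := by
    linarith [Real.log_le_sub_one_of_pos (x := 2 * x) (by linarith)]
  have h2 := exp_log_pi_add_div_lt hx
  rw [show 3 * (2 * x) = 6 * x by ring] at h2
  rw [aF, calR_eq_exp hx0, QR]
  set l := Real.log (2 * x)
  set B := Real.exp ((Real.log Real.pi + 1 / (6 * x)) / (2 * x))
  have hd : 0 < 2 * x - l := by linarith
  have hA : Real.exp (l / (2 * x)) ≤ 2 * x / (2 * x - l) := by
    have h := Real.one_sub_le_exp_neg (l / (2 * x))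
    rw [Real.exp_neg, le_inv_comm₀ (by rw [sub_pos, div_lt_one] <;> linarith)
      (Real.exp_pos _)] at h
    rwa [one_sub_div (by linarith), inv_div] at h
  have hAB : Real.exp (l / (2 * x)) * B < 2 * x / (2 * x - l) * (1 + 2 / (2 * x)) :=
    mul_lt_mul' hA h2 (Real.exp_pos _).le (by positivity)
  have e : l * ((2 / l + 1) * (x / (2 * x - l)))
      = (2 * x / (2 * x - l) * (1 + 2 / (2 * x)) - 1) * x := by
    have := hd.ne'
    field_simp
    ring
  rw [e]
  gcongr

theorem stmt4 : ∀ x : ℝ, Real.exp 1 / 2 ≤ x →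
    Real.log (2 * x) * QL x < aF calL x ∧ aF calR x < Real.log (2 * x) * QR x := by
  intro x hx
  have h : 27 / 10 ≤ 2 * x := by linarith [Real.exp_one_gt_d9]
  exact ⟨lt_aF_calL (by linarith) (Real.log_pos (by linarith)), aF_calR_lt h⟩
end

section
/- For all real x ≥ 3.92466, D(x) < 1. -/
/-- An upper bound for the logarithm at the left endpoint `2 * 3.92466`. -/
lemma log_endpoint_le : Real.log 7.84932 ≤ 2.06042695 := by
  have h := Real.abs_log_sub_add_sum_range_le (x := 0.018835) (by norm_num [abs_of_pos]) 5
  have h2 := Real.log_two_lt_d9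
  have e : Real.log 7.84932 = 3 * Real.log 2 + Real.log (1 - 0.018835) := by
    rw [show (7.84932 : ℝ) = 2 ^ 3 * (1 - 0.018835) by norm_num,
      Real.log_mul (by norm_num) (by norm_num), Real.log_pow]
    norm_num
  rw [abs_of_pos (show (0 : ℝ) < 0.018835 by norm_num)] at h
  have h3 := (abs_le.1 h).2
  norm_num [Finset.sum_range_succ] at h3 e ⊢
  linarith

/-- A lower bound for the logarithm of `π`. -/
lemma le_log_pi : 1.14472985 ≤ Real.log Real.pi := by
  have h := Real.abs_log_sub_add_sum_range_le (x := 0.2146018375) (by norm_num [abs_of_pos]) 13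
  have h2 := Real.log_two_gt_d9
  have hpi : Real.log 3.14159265 ≤ Real.log Real.pi :=
    Real.log_le_log (by norm_num) (by linarith [Real.pi_gt_d20])
  have e : Real.log 3.14159265 = 2 * Real.log 2 + Real.log (1 - 0.2146018375) := by
    rw [show (3.14159265 : ℝ) = 2 ^ 2 * (1 - 0.2146018375) by norm_num,
      Real.log_mul (by norm_num) (by norm_num), Real.log_pow]
    norm_num
  rw [abs_of_pos (show (0 : ℝ) < 0.2146018375 by norm_num)] at h
  have h3 := (abs_le.1 h).1
  norm_num [Finset.sum_range_succ] at h3 e hpi ⊢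
  linarith

lemma exp_two_le : Real.exp 2 ≤ 7.84932 := by
  have h : Real.exp 2 = Real.exp 1 * Real.exp 1 := by rw [← Real.exp_add]; norm_num
  rw [h]
  nlinarith [Real.exp_one_lt_d9, Real.exp_pos 1]

lemma log_div_le {y : ℝ} (hy : 7.84932 ≤ y) : Real.log y / y ≤ 2.06042695 / 7.84932 := by
  have h1 : Real.exp 1 ≤ 7.84932 := by linarith [Real.exp_one_lt_d9]
  calc Real.log y / y ≤ Real.log 7.84932 / 7.84932 :=
        Real.log_div_self_antitoneOn h1 (h1.trans hy) hy
    _ ≤ _ := by gcongr; exact log_endpoint_le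

lemma log_sq_div_le {y : ℝ} (hy : 7.84932 ≤ y) :
    Real.log y ^ 2 / y ≤ 2.06042695 ^ 2 / 7.84932 := by
  have h := Real.log_div_sqrt_antitoneOn exp_two_le (exp_two_le.trans hy) hy
  have hy0 : 0 ≤ Real.log y := Real.log_nonneg (by linarith)
  calc Real.log y ^ 2 / y = (Real.log y / √y) ^ 2 := by
        rw [div_pow, Real.sq_sqrt (by linarith)]
    _ ≤ (Real.log 7.84932 / √7.84932) ^ 2 := by gcongr
    _ = Real.log 7.84932 ^ 2 / 7.84932 := by rw [div_pow, Real.sq_sqrt (by norm_num)]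
    _ ≤ _ := by
        have := Real.log_nonneg (show (1 : ℝ) ≤ 7.84932 by norm_num)
        gcongr
        exact log_endpoint_le

/-- `D` written in terms of `log (2 * x) / (2 * x)` and `log (2 * x) ^ 2 / (2 * x)`. -/
lemma D_eq {x : ℝ} (hx : 0 < x) (hL : Real.log (2 * x) ≠ 0) (hlt : Real.log (2 * x) < 2 * x) :
    D x = (1 + Real.log (2 * x) ^ 2 / (2 * x) / 2) / (1 - Real.log (2 * x) / (2 * x)) -
      Real.log Real.pi / 2 * (1 + Real.log (2 * x) / (2 * x)) := by
  unfold D QR QL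
  generalize Real.log (2 * x) = L at *
  have h1 : 2 * x - L ≠ 0 := by linarith
  have h2 : 1 - L / (2 * x) ≠ 0 := by
    rw [one_sub_div (by positivity)]
    exact div_ne_zero h1 (by positivity)
  field_simp
  ring

theorem stmt9 : ∀ x : ℝ, (3.92466 : ℝ) ≤ x → D x < 1 := by
  intro x hx
  have hy : 7.84932 ≤ 2 * x := by linarith
  have hL : 0 < Real.log (2 * x) := Real.log_pos (by linarith)
  have ht0 : 0 < Real.log (2 * x) / (2 * x) := by positivity
  have ht := log_div_le hy
  have hs := log_sq_div_le hy
  have hpi := le_log_pi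
  have hlt : Real.log (2 * x) < 2 * x := by
    linarith [Real.log_le_sub_one_of_pos (show 0 < 2 * x by linarith)]
  rw [D_eq (by linarith) hL.ne' hlt]
  generalize Real.log (2 * x) / (2 * x) = t at *
  generalize Real.log (2 * x) ^ 2 / (2 * x) = s at *
  generalize Real.log Real.pi = a at *
  have ht2 : t ^ 2 ≤ (2.06042695 / 7.84932) ^ 2 := by gcongr
  have ht1 : 0 < 1 - t := by norm_num at ht ⊢; linarith
  have key : 1.14472985 * (1 - (2.06042695 / 7.84932) ^ 2) ≤ a * (1 - t ^ 2) := by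
    gcongr
  rw [sub_lt_iff_lt_add, div_lt_iff₀ ht1]
  norm_num at key hs ht
  linarith
end

section
/- The sequence (a_𝓛(n_{i+1}) − a_𝓛(n_i)) converges to 1 as i → ∞. -/
/-- `sigma n` is the largest positive integer `ℓ` with `n + (ℓ - 1) ≤ e * (n!)^(1/n)`. -/
noncomputable def sigma (n : ℕ) : ℕ :=
  sSup {ℓ : ℕ | 0 < ℓ ∧ (n : ℝ) + ((ℓ : ℝ) - 1) ≤ Real.exp 1 * (n.factorial : ℝ) ^ ((1 : ℝ) / n)}

/-- `nSeq i` is the `i`-th term (1-indexed) of the increasing enumeration of the set of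
positive integers `n` with `sigma (n+1) = sigma n + 1`. -/
noncomputable def nSeq (i : ℕ) : ℕ :=
  Nat.nth (fun n => 0 < n ∧ sigma (n + 1) = sigma n + 1) (i - 1)

open Filter Topology

/-- The logarithm of `n!` divided by `(n / e) ^ n`. -/
noncomputable def logFactorialRemainder (n : ℕ) : ℝ :=
  Real.log n.factorial - n * Real.log n + n

/-- The excess of `e * (n!)^(1/n)` over `n`. -/
noncomputable def factorialRootExcess (n : ℕ) : ℝ :=
  Real.exp 1 * (n.factorial : ℝ) ^ ((1 : ℝ) / n) - n

theorem tendsto_logFactorialRemainder_sub :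
    Tendsto (fun n : ℕ => logFactorialRemainder n - Real.log n / 2) atTop
      (𝓝 (Real.log (2 * Real.pi) / 2)) := by
  have h := (Stirling.tendsto_stirlingSeq_sqrt_pi.log (by positivity)).const_add (Real.log 2 / 2)
  have e : Real.log (2 * Real.pi) / 2 = Real.log 2 / 2 + Real.log (√Real.pi) := by
    rw [Real.log_mul (by norm_num) Real.pi_ne_zero, Real.log_sqrt Real.pi_pos.le]
    ring
  rw [e]
  refine h.congr' ?_
  filter_upwards [eventually_ge_atTop 1] with n hn
  have hn' : (n : ℝ) ≠ 0 := by positivity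
  rw [Stirling.log_stirlingSeq_formula, Real.log_mul (by norm_num) hn',
    Real.log_div hn' (Real.exp_ne_zero _), Real.log_exp, logFactorialRemainder]
  ring

theorem tendsto_div_sqrt_of_tendsto_sub_log {x : ℕ → ℝ} {c : ℝ}
    (hx : Tendsto (fun n : ℕ => x n - Real.log n / 2) atTop (𝓝 c)) :
    Tendsto (fun n : ℕ => x n / √n) atTop (𝓝 0) := by
  have hlog : Tendsto (fun n : ℕ => Real.log n / √n) atTop (𝓝 0) := by
    have h := ((isLittleO_log_rpow_atTop (r := 1 / 2) (by norm_num)).tendsto_div_nhds_zero).comp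
      (tendsto_natCast_atTop_atTop (R := ℝ))
    simpa [Function.comp_def, Real.sqrt_eq_rpow] using h
  have hsqrt : Tendsto (fun n : ℕ => √(n : ℝ)) atTop atTop :=
    Real.tendsto_sqrt_atTop.comp tendsto_natCast_atTop_atTop
  have h := (hx.div_atTop hsqrt).add (hlog.div_const 2)
  simp only [zero_div, add_zero] at h
  exact h.congr fun n => by ring

theorem tendsto_sq_div_of_tendsto_sub_log {x : ℕ → ℝ} {c : ℝ}
    (hx : Tendsto (fun n : ℕ => x n - Real.log n / 2) atTop (𝓝 c)) :
    Tendsto (fun n : ℕ => x n ^ 2 / n) atTop (𝓝 0) := by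
  have h := (tendsto_div_sqrt_of_tendsto_sub_log hx).pow 2
  rw [zero_pow two_ne_zero] at h
  exact h.congr fun n => by rw [div_pow, Real.sq_sqrt n.cast_nonneg]

theorem tendsto_mul_exp_div_sub_one_sub {x : ℕ → ℝ} {c : ℝ}
    (hx : Tendsto (fun n : ℕ => x n - Real.log n / 2) atTop (𝓝 c)) :
    Tendsto (fun n : ℕ => (Real.exp (x n / n) - 1) * n - x n) atTop (𝓝 0) := by
  have hsq := tendsto_sq_div_of_tendsto_sub_log hx
  refine squeeze_zero_norm' ?_ hsq
  filter_upwards [hsq.eventually_le_const one_pos, eventually_ge_atTop 1] with n hn hn1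
  have hn1' : (1 : ℝ) ≤ n := by exact_mod_cast hn1
  have hpos : (0 : ℝ) < n := by positivity
  have hle : |x n / n| ≤ 1 := by
    rw [← sq_le_one_iff_abs_le_one, div_pow, div_le_one (by positivity)]
    rw [div_le_one hpos] at hn
    nlinarith
  have hexp := Real.abs_exp_sub_one_sub_id_le hle
  have e : (Real.exp (x n / n) - 1) * n - x n = (Real.exp (x n / n) - 1 - x n / n) * n := by
    field_simp
  rw [e, Real.norm_eq_abs, abs_mul, abs_of_pos hpos]
  calc _ ≤ (x n / n) ^ 2 * n := by gcongr
    _ = x n ^ 2 / n := by field_simp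

theorem exp_one_mul_factorial_rpow {n : ℕ} (hn : 0 < n) :
    Real.exp 1 * (n.factorial : ℝ) ^ ((1 : ℝ) / n) =
      n * Real.exp (logFactorialRemainder n / n) := by
  have hn' : (0 : ℝ) < n := by exact_mod_cast hn
  have hfac : (0 : ℝ) < n.factorial := by exact_mod_cast n.factorial_pos
  have e : 1 + Real.log n.factorial * (1 / n) = Real.log n + logFactorialRemainder n / n := by
    rw [logFactorialRemainder]
    field_simp
    ring
  rw [Real.rpow_def_of_pos hfac, ← Real.exp_add, e, Real.exp_add, Real.exp_log hn']

theorem factorialRootExcess_eq {n : ℕ} (hn : 0 < n) :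
    factorialRootExcess n = (Real.exp (logFactorialRemainder n / n) - 1) * n := by
  rw [factorialRootExcess, exp_one_mul_factorial_rpow hn]
  ring

theorem tendsto_factorialRootExcess_sub :
    Tendsto (fun n => factorialRootExcess n - logFactorialRemainder n) atTop (𝓝 0) := by
  refine (tendsto_mul_exp_div_sub_one_sub tendsto_logFactorialRemainder_sub).congr' ?_
  filter_upwards [eventually_gt_atTop 0] with n hn
  rw [factorialRootExcess_eq hn]

theorem tendsto_logFactorialRemainder_atTop : Tendsto logFactorialRemainder atTop atTop := by
  have hlog : Tendsto (fun n : ℕ => Real.log n / 2) atTop atTop :=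
    (Real.tendsto_log_atTop.comp tendsto_natCast_atTop_atTop).atTop_div_const two_pos
  exact (tendsto_logFactorialRemainder_sub.add_atTop hlog).congr fun n => by ring

theorem tendsto_factorialRootExcess_atTop : Tendsto factorialRootExcess atTop atTop :=
  (tendsto_factorialRootExcess_sub.add_atTop tendsto_logFactorialRemainder_atTop).congr
    fun n => by ring

theorem tendsto_factorialRootExcess_succ_sub :
    Tendsto (fun n => factorialRootExcess (n + 1) - factorialRootExcess n) atTop (𝓝 0) := by
  have hstep {f : ℕ → ℝ} {c : ℝ} (hf : Tendsto f atTop (𝓝 c)) :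
      Tendsto (fun n => f (n + 1) - f n) atTop (𝓝 0) := by
    simpa using (hf.comp (tendsto_add_atTop_nat 1)).sub hf
  have h := ((hstep tendsto_factorialRootExcess_sub).add
    (hstep tendsto_logFactorialRemainder_sub)).add
    (Real.tendsto_log_nat_add_one_sub_log.div_const 2)
  simp only [zero_div, add_zero] at h
  refine h.congr fun n => ?_
  push_cast
  ring

theorem aF_calL_eq {x : ℝ} (hx : 0 < x) :
    aF calL x = (Real.exp ((Real.log (2 * Real.pi) / 2 + Real.log x / 2 +
      1 / (12 * x + 1)) / x) - 1) * x := by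
  have h2x : 0 < 2 * x := by positivity
  rw [aF, calL, L, P, Real.rpow_def_of_pos Real.pi_pos, Real.rpow_def_of_pos h2x,
    ← Real.exp_add, ← Real.exp_add, Real.log_mul two_ne_zero hx.ne',
    Real.log_mul two_ne_zero Real.pi_ne_zero]
  congr 3
  field_simp
  ring

theorem tendsto_aF_calL_sub_factorialRootExcess :
    Tendsto (fun n : ℕ => aF calL n - factorialRootExcess n) atTop (𝓝 0) := by
  set x : ℕ → ℝ := fun n =>
    Real.log (2 * Real.pi) / 2 + Real.log n / 2 + 1 / (12 * (n : ℝ) + 1) with hx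
  have hden : Tendsto (fun n : ℕ => 1 / (12 * (n : ℝ) + 1)) atTop (𝓝 0) := by
    refine tendsto_const_nhds.div_atTop (tendsto_atTop_add_const_right _ _ ?_)
    exact tendsto_natCast_atTop_atTop.const_mul_atTop (by norm_num)
  have hxlog : Tendsto (fun n : ℕ => x n - Real.log n / 2) atTop
      (𝓝 (Real.log (2 * Real.pi) / 2)) := by
    have h := hden.const_add (Real.log (2 * Real.pi) / 2)
    rw [add_zero] at h
    exact h.congr fun n => by rw [hx]; ring
  have h := ((tendsto_mul_exp_div_sub_one_sub hxlog).sub tendsto_factorialRootExcess_sub).add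
    (hxlog.sub tendsto_logFactorialRemainder_sub)
  simp only [sub_self, add_zero] at h
  refine h.congr' ?_
  filter_upwards [eventually_gt_atTop 0] with n hn
  rw [aF_calL_eq (by exact_mod_cast hn : (0 : ℝ) < n)]
  ring

theorem logFactorialRemainder_succ_div_sub {n : ℕ} (hn : 0 < n) :
    Real.log (n + 1) + logFactorialRemainder (n + 1) / (n + 1 : ℝ) -
        (Real.log n + logFactorialRemainder n / n) =
      (n * (Real.log (n + 1) - Real.log n) + n - logFactorialRemainder n) / (n * (n + 1)) := by
  have hn' : (n : ℝ) ≠ 0 := by positivity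
  have hn1 : (n : ℝ) + 1 ≠ 0 := by positivity
  have hfac : (n.factorial : ℝ) ≠ 0 := by positivity
  rw [logFactorialRemainder, logFactorialRemainder, Nat.factorial_succ]
  push_cast
  rw [Real.log_mul hn1 hfac]
  field_simp
  ring

/-- The inequality behind the monotonicity of `n ↦ e * (n!)^(1/n) - n`. -/
theorem one_le_mul_exp_sub_one {n s c d u : ℝ} (hn : 1 ≤ n) (hs : 0 ≤ s)
    (hsn : s ^ 2 + 1 ≤ n / 16) (hc : n / (n + 1) ≤ c) (hu : n + s ≤ u)
    (hd : d = (c + n - s) / (n * (n + 1))) : 1 ≤ u * (Real.exp d - 1) := by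
  have hpos : 0 < n * (n + 1) := by positivity
  have hc' : n ≤ c * (n + 1) := (div_le_iff₀ (by positivity)).1 hc
  have hc0 : 0 ≤ c := le_trans (by positivity) hc
  have hs2 : s ≤ n / 2 := by nlinarith
  have hdlow : 1 / (2 * (n + 1)) ≤ d := by
    rw [hd, div_le_div_iff₀ (by positivity) hpos]
    nlinarith
  have hd0 : 0 ≤ d := le_trans (by positivity) hdlow
  have hexp := Real.quadratic_le_exp_of_nonneg hd0
  have hlin : 1 - (1 + s ^ 2) / (n * (n + 1)) ≤ (n + s) * d := by
    rw [hd, ← mul_div_assoc, one_sub_div hpos.ne', div_le_div_iff_of_pos_right hpos]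
    nlinarith [mul_nonneg hs hc0]
  have hquad : (1 + s ^ 2) / (n * (n + 1)) ≤ (n + s) * (d ^ 2 / 2) := by
    have h1 : n * ((1 / (2 * (n + 1))) ^ 2 / 2) ≤ (n + s) * (d ^ 2 / 2) := by
      gcongr
      linarith
    refine le_trans ?_ h1
    have e : n * ((1 / (2 * (n + 1))) ^ 2 / 2) = n / (8 * (n + 1) ^ 2) := by
      field_simp
      norm_num
    rw [e, div_le_div_iff₀ hpos (by positivity)]
    have h2 : (1 + s ^ 2) * 8 * (n + 1) ≤ n * n := by nlinarith
    nlinarith [mul_le_mul_of_nonneg_right h2 (by positivity : 0 ≤ n + 1)]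
  calc (1 : ℝ) ≤ (n + s) * (d + d ^ 2 / 2) := by linarith
    _ ≤ u * (Real.exp d - 1) := by
      gcongr
      · linarith
      · linarith

theorem eventually_factorialRootExcess_le_succ :
    ∀ᶠ n in atTop, factorialRootExcess n ≤ factorialRootExcess (n + 1) := by
  have hsq := tendsto_sq_div_of_tendsto_sub_log tendsto_logFactorialRemainder_sub
  filter_upwards [hsq.eventually_le_const (by norm_num : (0 : ℝ) < 1 / 32),
    tendsto_logFactorialRemainder_atTop.eventually_ge_atTop 0,
    eventually_ge_atTop 32] with n hn hs hn32
  have hn32' : (32 : ℝ) ≤ n := by exact_mod_cast hn32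
  have hpos : (0 : ℝ) < n := by linarith
  have hpos1 : (0 : ℝ) < n + 1 := by linarith
  rw [div_le_iff₀ hpos] at hn
  have hn0 : 0 < n := by omega
  have hc : (n : ℝ) / (n + 1) ≤ n * (Real.log (n + 1) - Real.log n) := by
    have h := Real.one_sub_inv_le_log_of_pos (div_pos hpos1 hpos)
    rw [Real.log_div hpos1.ne' hpos.ne', inv_div] at h
    rw [div_eq_mul_inv]
    gcongr
    refine le_trans (le_of_eq ?_) h
    field_simp
    ring
  have hu : n + logFactorialRemainder n ≤ n * Real.exp (logFactorialRemainder n / n) := by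
    calc n + logFactorialRemainder n = n * (logFactorialRemainder n / n + 1) := by
          field_simp
          ring
      _ ≤ _ := by gcongr; exact Real.add_one_le_exp _
  have h := one_le_mul_exp_sub_one (by linarith) hs (by linarith) hc hu
    (logFactorialRemainder_succ_div_sub hn0)
  have hexp : (n + 1 : ℝ) * Real.exp (logFactorialRemainder (n + 1) / (n + 1 : ℝ)) =
      n * Real.exp (logFactorialRemainder n / n) *
        Real.exp (Real.log (n + 1) + logFactorialRemainder (n + 1) / (n + 1 : ℝ) -
          (Real.log n + logFactorialRemainder n / n)) := by
    rw [Real.exp_sub, Real.exp_add, Real.exp_add, Real.exp_log hpos, Real.exp_log hpos1]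
    field_simp
  rw [factorialRootExcess, factorialRootExcess, exp_one_mul_factorial_rpow hn0,
    exp_one_mul_factorial_rpow n.succ_pos]
  push_cast
  rw [hexp]
  linarith

theorem sigma_eq_floor_add_one {n : ℕ} (hn : 0 ≤ factorialRootExcess n) :
    sigma n = ⌊factorialRootExcess n⌋₊ + 1 := by
  refine IsGreatest.csSup_eq ⟨⟨Nat.succ_pos _, ?_⟩, ?_⟩
  · have h := Nat.floor_le hn
    rw [factorialRootExcess] at h ⊢
    push_cast
    linarith
  · rintro l ⟨hl, hle⟩
    obtain ⟨k, rfl⟩ := Nat.exists_eq_add_of_lt hl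
    have : k ≤ ⌊factorialRootExcess n⌋₊ := by
      rw [Nat.le_floor_iff hn, factorialRootExcess]
      push_cast at hle
      linarith
    omega

/-- If `g` tends to infinity, is eventually monotone and has steps tending to `0`, then `g`
increases by `1 + o(1)` between consecutive jumps of `⌊g⌋₊ + 1`. -/
theorem tendsto_sub_nth_jump {g : ℕ → ℝ} {s : ℕ → ℕ} (hg : Tendsto g atTop atTop)
    (hmono : ∀ᶠ n in atTop, g n ≤ g (n + 1))
    (hstep : Tendsto (fun n => g (n + 1) - g n) atTop (𝓝 0))
    (hs : ∀ᶠ n in atTop, s n = ⌊g n⌋₊ + 1) :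
    Tendsto (Nat.nth fun n => 0 < n ∧ s (n + 1) = s n + 1) atTop atTop ∧
      Tendsto (fun i => g (Nat.nth (fun n => 0 < n ∧ s (n + 1) = s n + 1) (i + 1)) -
        g (Nat.nth (fun n => 0 < n ∧ s (n + 1) = s n + 1) i)) atTop (𝓝 1) := by
  set q : ℕ → Prop := fun n => 0 < n ∧ s (n + 1) = s n + 1 with hq
  obtain ⟨N, hN⟩ := eventually_atTop.1 (((hmono.and (hstep.eventually_lt_const one_pos)).and
    (hs.and (hg.eventually_ge_atTop 0))).and (eventually_gt_atTop 0))
  have hsfloor : ∀ n ≥ N, s n = ⌊g n⌋₊ + 1 := fun n hn => (hN n hn).1.2.1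
  have hlt : ∀ n ≥ N, g n < s n := fun n hn => by
    rw [hsfloor n hn]
    exact_mod_cast Nat.lt_floor_add_one (g n)
  have hle : ∀ n ≥ N, (s n : ℝ) ≤ g n + 1 := fun n hn => by
    rw [hsfloor n hn]
    push_cast
    linarith [Nat.floor_le (hN n hn).1.2.2]
  have hconst : ∀ n ≥ N, ¬ q n → s (n + 1) = s n := fun n hn hnq => by
    have h1 : s n ≤ s (n + 1) := by
      rw [hsfloor n hn, hsfloor (n + 1) (by omega)]
      exact Nat.succ_le_succ (Nat.floor_mono (hN n hn).1.1.1)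
    have h2 : s (n + 1) < s n + 2 := by
      have : (s (n + 1) : ℝ) < s n + 2 := by
        linarith [hle (n + 1) (by omega), hlt n hn, (hN n hn).1.1.2]
      exact_mod_cast this
    have h3 : s (n + 1) ≠ s n + 1 := fun h => hnq ⟨(hN n hn).2, h⟩
    omega
  have hconst_of_gap : ∀ a ≥ N, ∀ b ≥ a, (∀ n, a ≤ n → n < b → ¬ q n) → s b = s a := by
    intro a ha b hb
    induction b, hb using Nat.le_induction with
    | base => exact fun _ => rfl
    | succ b hb ih =>
      intro h
      rw [hconst b (ha.trans hb) (h b hb b.lt_succ_self),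
        ih fun n h1 h2 => h n h1 (h2.trans b.lt_succ_self)]
  have hinf : (Set.ofPred q).Infinite := by
    intro hfin
    obtain ⟨M, hM⟩ := hfin.bddAbove
    set K := max N (M + 1)
    obtain ⟨b, hb, hKb⟩ :=
      ((hg.eventually_gt_atTop (s K : ℝ)).and (eventually_ge_atTop K)).exists
    have hsb := hconst_of_gap K (le_max_left _ _) b hKb fun n hn _ hqn => by
      have := hM hqn
      have := le_max_right N (M + 1)
      omega
    have := hlt b ((le_max_left _ _).trans hKb)
    rw [hsb] at this
    linarith
  have hnth : Tendsto (Nat.nth q) atTop atTop := (Nat.nth_strictMono hinf).tendsto_atTop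
  refine ⟨hnth, ?_⟩
  have hjump : ∀ᶠ i in atTop, s (Nat.nth q (i + 1)) = s (Nat.nth q i) + 1 := by
    filter_upwards [hnth.eventually_ge_atTop N] with i hi
    rw [hconst_of_gap (Nat.nth q i + 1) (by omega) _
      (Nat.nth_strictMono hinf i.lt_succ_self) fun n h1 h2 hqn => by
        have := Nat.le_nth_of_lt_nth_succ h2 hqn
        omega]
    exact (Nat.nth_mem_of_infinite hinf i).2
  have hclose : Tendsto (fun i => g (Nat.nth q i) - s (Nat.nth q i)) atTop (𝓝 0) := by
    refine squeeze_zero_norm' ?_ (hstep.comp hnth)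
    filter_upwards [hnth.eventually_ge_atTop N] with i hi
    have h1 := hlt _ hi
    have h2 := hle (Nat.nth q i + 1) (by omega)
    rw [(Nat.nth_mem_of_infinite hinf i).2] at h2
    push_cast at h2
    rw [Real.norm_eq_abs, abs_of_neg (by linarith), Function.comp_apply]
    linarith
  have h := ((hclose.comp (tendsto_add_atTop_nat 1)).sub hclose).add_const 1
  rw [sub_zero, zero_add] at h
  refine h.congr' ?_
  filter_upwards [hjump] with i hi
  simp only [Function.comp_apply, hi]
  push_cast
  ring

theorem stmt11 :
    Filter.Tendsto (fun i : ℕ => aF calL (nSeq (i + 1)) - aF calL (nSeq i))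
      Filter.atTop (nhds 1) := by
  obtain ⟨hnth, hgap⟩ := tendsto_sub_nth_jump tendsto_factorialRootExcess_atTop
    eventually_factorialRootExcess_le_succ tendsto_factorialRootExcess_succ_sub
    ((tendsto_factorialRootExcess_atTop.eventually_ge_atTop 0).mono
      fun _ => sigma_eq_floor_add_one)
  have hdiff := tendsto_aF_calL_sub_factorialRootExcess.comp hnth
  have h := ((hdiff.comp (tendsto_add_atTop_nat 1)).sub hdiff).add hgap
  rw [sub_zero, zero_add] at h
  refine (h.comp (tendsto_sub_atTop_nat 1)).congr' ?_
  filter_upwards [eventually_ge_atTop 1] with i hi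
  simp only [Function.comp_apply, nSeq, Nat.sub_add_cancel hi, Nat.add_sub_cancel]
  ring
end
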